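/- Over the 3-periodic billiard family, the nine-point center X₅† of the focus-inversive triangle lies on the circle with center C₅† = (c(−1 + ρ²(a⁴ − 3a²b² + 2b⁴ + 2b²δ)/(4a²b⁴)), 0) and radius R₅† = ρ²((3a² − 2b²)b² + (a² − 2b²)δ)/(4ab²·b²). -/

import Mathlib

noncomputable section

namespace BilliardInv

/-- A point of the plane. -/
abbrev Pt := ℝ × ℝ

/-- Euclidean dot product. -/
def dot (p q : Pt) : ℝ := p.1 * q.1 + p.2 * q.2

/-- Euclidean distance. -/
def dst (p q : Pt) : ℝ := Real.sqrt ((p.1 - q.1) ^ 2 + (p.2 - q.2) ^ 2)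

/-- Membership in the ellipse x²/a² + y²/b² = 1. -/
def onEllipse (a b : ℝ) (p : Pt) : Prop := p.1 ^ 2 / a ^ 2 + p.2 ^ 2 / b ^ 2 = 1

/-- Half the gradient of f(x,y) = x²/a² + y²/b² (an outward normal direction). -/
def nrm (a b : ℝ) (p : Pt) : Pt := (p.1 / a ^ 2, p.2 / b ^ 2)

/-- Unit vector pointing from `v` toward `q`. -/
def udir (v q : Pt) : Pt := (dst v q)⁻¹ • (q - v)

/-- The billiard reflection law at vertex `v` with neighboring vertices `q`, `r`:
the two adjacent sides make equal angles with the ellipse normal at `v`. -/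
def reflectAt (a b : ℝ) (q v r : Pt) : Prop :=
  dot (udir v q) (nrm a b v) = dot (udir v r) (nrm a b v)

/-- A 3-periodic billiard orbit in the ellipse with semi-axes `a > b > 0`:
a nondegenerate triangle inscribed in the ellipse obeying the reflection
law at each vertex. -/
structure Orbit3 (a b : ℝ) : Type where
  P1 : Pt
  P2 : Pt
  P3 : Pt
  h1 : onEllipse a b P1
  h2 : onEllipse a b P2
  h3 : onEllipse a b P3
  d12 : P1 ≠ P2
  d23 : P2 ≠ P3
  d31 : P3 ≠ P1
  r1 : reflectAt a b P3 P1 P2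
  r2 : reflectAt a b P1 P2 P3
  r3 : reflectAt a b P2 P3 P1

/-- Inversion of `p` with respect to the circle of radius `ρ` centered at `f`. -/
def inva (ρ : ℝ) (f p : Pt) : Pt :=
  f + (ρ ^ 2 / ((p.1 - f.1) ^ 2 + (p.2 - f.2) ^ 2)) • (p - f)

/-- Unsigned area of a triangle. -/
def area (A B C : Pt) : ℝ :=
  |(B.1 - A.1) * (C.2 - A.2) - (B.2 - A.2) * (C.1 - A.1)| / 2

/-- The point with barycentric coordinates wA : wB : wC w.r.t. triangle ABC. -/
def bary (wA wB wC : ℝ) (A B C : Pt) : Pt :=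
  (wA + wB + wC)⁻¹ • (wA • A + wB • B + wC • C)

/-- Side length a = |BC|. -/
def sA (A B C : Pt) : ℝ := dst B C
/-- Side length b = |CA|. -/
def sB (A B C : Pt) : ℝ := dst C A
/-- Side length c = |AB|. -/
def sC (A B C : Pt) : ℝ := dst A B

/-- Incenter X(1). -/
def incenter (A B C : Pt) : Pt := bary (sA A B C) (sB A B C) (sC A B C) A B C

/-- Barycenter (centroid) X(2). -/
def centroid (A B C : Pt) : Pt := bary 1 1 1 A B C

/-- Circumcenter X(3), via its barycentric coordinates a²(b²+c²−a²) : · : ·. -/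
def circumcenter (A B C : Pt) : Pt :=
  bary (sA A B C ^ 2 * (sB A B C ^ 2 + sC A B C ^ 2 - sA A B C ^ 2))
       (sB A B C ^ 2 * (sC A B C ^ 2 + sA A B C ^ 2 - sB A B C ^ 2))
       (sC A B C ^ 2 * (sA A B C ^ 2 + sB A B C ^ 2 - sC A B C ^ 2)) A B C

/-- Orthocenter X(4) = A + B + C − 2·(circumcenter). -/
def orthocenter (A B C : Pt) : Pt := A + B + C - (2 : ℝ) • circumcenter A B C

/-- Nine-point center X(5): midpoint of circumcenter and orthocenter. -/
def ninePointCenter (A B C : Pt) : Pt :=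
  ((1 : ℝ) / 2) • (circumcenter A B C + orthocenter A B C)

/-- Gergonne point X(7), barycentrics 1/(b+c−a) : 1/(c+a−b) : 1/(a+b−c). -/
def gergonne (A B C : Pt) : Pt :=
  bary (sB A B C + sC A B C - sA A B C)⁻¹
       (sC A B C + sA A B C - sB A B C)⁻¹
       (sA A B C + sB A B C - sC A B C)⁻¹ A B C

/-- Mittenpunkt X(9), barycentrics a(b+c−a) : b(c+a−b) : c(a+b−c). -/
def mittenpunkt (A B C : Pt) : Pt :=
  bary (sA A B C * (sB A B C + sC A B C - sA A B C))
       (sB A B C * (sC A B C + sA A B C - sB A B C))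
       (sC A B C * (sA A B C + sB A B C - sC A B C)) A B C

/-- Feuerbach point X(11), barycentrics (b+c−a)(b−c)² : · : ·. -/
def feuerbach (A B C : Pt) : Pt :=
  bary ((sB A B C + sC A B C - sA A B C) * (sB A B C - sC A B C) ^ 2)
       ((sC A B C + sA A B C - sB A B C) * (sC A B C - sA A B C) ^ 2)
       ((sA A B C + sB A B C - sC A B C) * (sA A B C - sB A B C) ^ 2) A B C

/-- Triangle center X(100), barycentrics a/(b−c) : b/(c−a) : c/(a−b). -/
def X100 (A B C : Pt) : Pt :=
  bary (sA A B C / (sB A B C - sC A B C))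
       (sB A B C / (sC A B C - sA A B C))
       (sC A B C / (sA A B C - sB A B C)) A B C

/-- Orthogonal projection of `Q` onto the line through `A` and `B`. -/
def projLine (Q A B : Pt) : Pt :=
  A + (dot (Q - A) (B - A) / dot (B - A) (B - A)) • (B - A)

/-- Unsigned area of the pedal triangle of `Q` w.r.t. triangle `A B C`. -/
def pedalArea (Q A B C : Pt) : ℝ :=
  area (projLine Q A B) (projLine Q B C) (projLine Q C A)

end BilliardInv

open BilliardInv Real

/-- The barycentric circumcenter is the unique equidistant point. -/
lemma cc_eq (A B C O : Pt)
    (h1 : (A.1 - O.1)^2 + (A.2 - O.2)^2 = (B.1 - O.1)^2 + (B.2 - O.2)^2)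
    (h2 : (A.1 - O.1)^2 + (A.2 - O.2)^2 = (C.1 - O.1)^2 + (C.2 - O.2)^2)
    (hW : (B.1 - A.1) * (C.2 - A.2) - (B.2 - A.2) * (C.1 - A.1) ≠ 0) :
    circumcenter A B C = O := by
  obtain ⟨x1, y1⟩ := A
  obtain ⟨x2, y2⟩ := B
  obtain ⟨x3, y3⟩ := C
  obtain ⟨x, y⟩ := O
  have sq : ∀ p q : Pt, dst p q ^ 2 = (p.1 - q.1)^2 + (p.2 - q.2)^2 := by
    intro p q
    unfold dst
    exact Real.sq_sqrt (by positivity)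
  simp only [circumcenter, bary, sA, sB, sC, sq] at *
  obtain ⟨W, hWd⟩ : ∃ W, W = (x2 - x1) * (y3 - y1) - (y2 - y1) * (x3 - x1) := ⟨_, rfl⟩
  rw [← hWd] at hW
  have hx : 2 * W * (x - x1) = ((x2-x1)^2+(y2-y1)^2) * (y3-y1) - ((x3-x1)^2+(y3-y1)^2) * (y2-y1) := by
    rw [hWd]; linear_combination (y3-y1) * h1 - (y2-y1) * h2
  have hy : 2 * W * (y - y1) = -((x2-x1)^2+(y2-y1)^2) * (x3-x1) + ((x3-x1)^2+(y3-y1)^2) * (x2-x1) := by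
    rw [hWd]; linear_combination -(x3-x1) * h1 + (x2-x1) * h2
  have htot : ∀ t, t = 4 * W^2 → t ≠ 0 := by
    intro t ht; rw [ht]; positivity
  ext
  · simp only [Prod.smul_fst, Prod.fst_add, smul_eq_mul]
    rw [inv_mul_eq_div, div_eq_iff]
    · subst hWd
      linear_combination (-2 * ((x2 - x1) * (y3 - y1) - (y2 - y1) * (x3 - x1))) * hx
    · apply htot; rw [hWd]; ring
  · simp only [Prod.smul_snd, Prod.snd_add, smul_eq_mul]
    rw [inv_mul_eq_div, div_eq_iff]
    · subst hWd
      linear_combination (-2 * ((x2 - x1) * (y3 - y1) - (y2 - y1) * (x3 - x1))) * hy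
    · apply htot; rw [hWd]; ring

/-- Three distinct unit vectors are not collinear. -/
lemma unit_W (u1 v1 u2 v2 u3 v3 : ℝ) (n1 : u1^2+v1^2=1) (n2 : u2^2+v2^2=1) (n3 : u3^2+v3^2=1)
    (d12 : u1*u2+v1*v2 ≠ 1) (d23 : u2*u3+v2*v3 ≠ 1) (d31 : u3*u1+v3*v1 ≠ 1) :
    (u2-u1)*(v3-v1) - (v2-v1)*(u3-u1) ≠ 0 := by
  intro h
  have key : ((u2-u1)*(v3-v1) - (v2-v1)*(u3-u1))^2
      = 2*(1-(u1*u2+v1*v2))*(1-(u2*u3+v2*v3))*(1-(u3*u1+v3*v1)) := by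
    grind
  rw [h] at key
  have : (1-(u1*u2+v1*v2))*(1-(u2*u3+v2*v3))*(1-(u3*u1+v3*v1)) = 0 := by linarith
  rcases mul_eq_zero.1 this with h | h
  · rcases mul_eq_zero.1 h with h | h
    · exact d12 (by linarith)
    · exact d23 (by linarith)
  · exact d31 (by linarith)

/-- Focal (true anomaly) parametrization. -/
lemma param (a b c : ℝ) (hb : 0 < b) (hc : 0 < c) (hab : b < a) (hcc : c^2 = a^2-b^2) (p : Pt)
    (h : onEllipse a b p) : ∃ u v d : ℝ, u^2+v^2=1 ∧ d = a - c*u ∧ 0 < d ∧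
      p.1 = b^2*u/d - c ∧ p.2 = b^2*v/d := by
  obtain ⟨x, y⟩ := p
  simp only [onEllipse] at *
  have ha : 0 < a := by linarith
  field_simp at h
  have hca : c < a := by nlinarith
  have hx : x^2 ≤ a^2 := by
    by_contra hh
    nlinarith [mul_pos hb hb, mul_nonneg (sq_nonneg a) (sq_nonneg y)]
  have hx' := abs_le.1 (abs_le_of_sq_le_sq hx ha.le)
  obtain ⟨r, hr⟩ : ∃ r, r = a^2 + c*x := ⟨_, rfl⟩
  have hr0 : 0 < r := by rw [hr]; nlinarith
  refine ⟨a*(x+c)/r, a*y/r, a*b^2/r, ?_, ?_, by positivity, ?_, ?_⟩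
  · field_simp
    rw [hr]
    linear_combination h + (a^2 - x^2) * hcc
  · field_simp
    rw [hr]
    linear_combination hcc
  · field_simp; ring
  · field_simp

/-- Pair relation for a chord with Joachimsthal constant. -/
lemma pair (a b c L : ℝ) (hb : 0 < b) (hab : b < a) (hcc : c^2 = a^2-b^2)
    (u v u' v' d d' : ℝ) (n : u^2+v^2=1) (n' : u'^2+v'^2=1) (hdd : d = a - c*u) (hdd' : d' = a-c*u')
    (hd : 0 < d) (hd' : 0 < d')
    (hne : u*u'+v*v' ≠ 1)
    (h : ((b^2*u/d - c)*(b^2*u'/d' - c)/a^2 + (b^2*v/d)*(b^2*v'/d')/b^2 - 1)^2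
      = L * (((b^2*u/d - c) - (b^2*u'/d' - c))^2 + ((b^2*v/d) - (b^2*v'/d'))^2)) :
    1 - (u*u'+v*v') = L * (2*a^2+c^2 - 2*a*c*(u+u') + c^2*(u*u'+v*v')) := by
  have ha : 0 < a := by linarith
  have e1 : (b^2*u/d - c)*(b^2*u'/d' - c)/a^2 + (b^2*v/d)*(b^2*v'/d')/b^2 - 1
      = - (b^2*(1-(u*u'+v*v'))/(d*d')) := by
    have hb2 : b^2 = a^2 - c^2 := by linarith
    field_simp
    rw [hb2, hdd, hdd']; ring
  have e2 : ((b^2*u/d - c) - (b^2*u'/d' - c))^2 + ((b^2*v/d) - (b^2*v'/d'))^2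
      = b^4*(1-(u*u'+v*v'))*(2*a^2+c^2 - 2*a*c*(u+u') + c^2*(u*u'+v*v'))/(d*d')^2 := by
    have hp : (u*d' - u'*d)^2 + (v*d' - v'*d)^2
        = (1-(u*u'+v*v'))*(2*a^2+c^2 - 2*a*c*(u+u') + c^2*(u*u'+v*v')) := by
      have g1 : (u*d' - u'*d)^2 + (v*d' - v'*d)^2 = d'^2 + d^2 - 2*d*d'*(u*u'+v*v') := by
        linear_combination d'^2*n + d^2*n'
      have g2 : u^2 + u'^2 - 2*u*u'*(u*u'+v*v') = 1 - (u*u'+v*v')^2 := by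
        linear_combination v^2*n' + (1-u'^2)*n
      rw [g1, hdd, hdd']
      linear_combination c^2 * g2
    field_simp
    linear_combination b^4 * hp
  rw [e1, e2] at h
  have hne' : 1 - (u*u'+v*v') ≠ 0 := fun h => hne (by linarith)
  field_simp at h
  linarith

/-- Constant sum of the focal directions, and the Joachimsthal constant. -/
lemma sums (a b c δ L : ℝ) (hb : 0 < b) (hc : 0 < c) (hab : b < a) (hcc : c^2 = a^2-b^2) (hL : 0 ≤ L)
    (hδ : 0 < δ) (hδδ : δ^2 = a^4-a^2*b^2+b^4)
    (u1 v1 u2 v2 u3 v3 : ℝ) (n1 : u1^2+v1^2=1) (n2 : u2^2+v2^2=1) (n3 : u3^2+v3^2=1)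
    (hW : (u2-u1)*(v3-v1) - (v2-v1)*(u3-u1) ≠ 0)
    (r12 : 1 - (u1*u2+v1*v2) = L * (2*a^2+c^2 - 2*a*c*(u1+u2) + c^2*(u1*u2+v1*v2)))
    (r23 : 1 - (u2*u3+v2*v3) = L * (2*a^2+c^2 - 2*a*c*(u2+u3) + c^2*(u2*u3+v2*v3)))
    (r31 : 1 - (u3*u1+v3*v1) = L * (2*a^2+c^2 - 2*a*c*(u3+u1) + c^2*(u3*u1+v3*v1))) :
    v1+v2+v3 = 0 ∧ (u1+u2+u3)*(a*c) = 2*a^2-b^2-δ := by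
  have hM : 0 < 1 + L*c^2 := by positivity
  have ha : 0 < a := by linarith
  -- the vector Z = M Σw - 2Lac e is orthogonal to two independent differences
  have o12 : (u1-u2)*((1+L*c^2)*(u1+u2+u3) - 2*L*a*c) + (v1-v2)*((1+L*c^2)*(v1+v2+v3)) = 0 := by
    linear_combination r23 - r31 + (1+L*c^2)*(n1-n2)
  have o13 : (u1-u3)*((1+L*c^2)*(u1+u2+u3) - 2*L*a*c) + (v1-v3)*((1+L*c^2)*(v1+v2+v3)) = 0 := by
    linear_combination r23 - r12 + (1+L*c^2)*(n1-n3)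
  have hU : (1+L*c^2)*(u1+u2+u3) = 2*L*a*c := by
    have : ((u2-u1)*(v3-v1) - (v2-v1)*(u3-u1)) * ((1+L*c^2)*(u1+u2+u3) - 2*L*a*c) = 0 := by
      linear_combination (v1-v3)*o12 - (v1-v2)*o13
    rcases mul_eq_zero.1 this with h | h
    · exact absurd h hW
    · linarith
  have hV : v1+v2+v3 = 0 := by
    have : ((u2-u1)*(v3-v1) - (v2-v1)*(u3-u1)) * ((1+L*c^2)*(v1+v2+v3)) = 0 := by
      linear_combination -(u1-u3)*o12 + (u1-u2)*o13
    rcases mul_eq_zero.1 this with h | h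
    · exact absurd h hW
    · rcases mul_eq_zero.1 h with h | h
      · exact absurd h hM.ne'
      · exact h
  refine ⟨hV, ?_⟩
  obtain ⟨s, hs⟩ : ∃ s, s = u1+u2+u3 := ⟨_, rfl⟩
  rw [← hs] at hU ⊢
  have k12 : (u1*u2+v1*v2) - s*(u1+u2) = -(1+s^2)/2 := by
    have e3 : u3 = s - u1 - u2 := by linarith
    have f3 : v3 = - v1 - v2 := by linarith
    rw [e3, f3] at n3
    linear_combination (n3 - n1 - n2)/2
  have q0 : (1+L*c^2)*(1+s^2) = -2*(1 - L*(2*a^2+c^2)) := by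
    linear_combination 2*(1+L*c^2)*k12 + 2*r12 + 2*(u1+u2)*hU
  have q1 : L^2*c^4 + L*(4*a^2-2*c^2) - 3 = 0 := by
    linear_combination -(1+L*c^2)*q0 + ((1+L*c^2)*s + 2*L*a*c)*hU
  have q2 : (L*c^4 + a^2+b^2)^2 = (2*δ)^2 := by
    have hb2 : b^2 = a^2 - c^2 := by linarith
    have hb4 : b^4 = (a^2-c^2)^2 := by rw [← hb2]; ring
    rw [mul_pow, hδδ, hb4, hb2]
    linear_combination c^4*q1
  have q3 : L*c^4 + a^2+b^2 = 2*δ := by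
    have := abs_eq_abs.2 (sq_eq_sq_iff_eq_or_eq_neg.1 q2)
    rwa [abs_of_pos (by positivity), abs_of_pos (by positivity)] at this
  have hδb : b^2 < δ := by
    have : (b^2)^2 < δ^2 := by
      rw [hδδ]
      have : 0 < a^2*c^2 := by positivity
      rw [hcc] at this
      nlinarith
    exact lt_of_pow_lt_pow_left₀ 2 hδ.le this
  have t : 2*(δ-b^2)*(s*(a*c)) = 2*(δ-b^2)*(2*a^2-b^2-δ) := by
    have : 2*(δ-b^2)*s*c = 2*a*(L*c^4) := by
      linear_combination c^3*hU - s*c*q3 - s*c*hcc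
    linear_combination a*this + 2*a^2*q3 + 2*hδδ
  exact mul_left_cancel₀ (by have := sub_pos.2 hδb; positivity) t

/-- Distance of a limaçon point to the circumcenter (up to terms independent of the vertex). -/
lemma equi (h s : ℝ) (u1 v1 u2 v2 u3 v3 : ℝ) (n1 : u1^2+v1^2=1) (n2 : u2^2+v2^2=1) (n3 : u3^2+v3^2=1)
    (hs : u1+u2+u3 = s) (hv : v1+v2+v3=0) (X Y : ℝ)
    (hX : X = (u1*u2-v1*v2)*u3 - (u1*v2+v1*u2)*v3)
    (hY : Y = (u1*u2-v1*v2)*v3 + (u1*v2+v1*u2)*u3) :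
    ((1-h*s)^2-h^2)*u1 - ((1-h*s+h*X)*(u1-h*(u1^2-v1^2)) + h*Y*(v1-2*h*u1*v1))
      = h*(-(1-h*s)*s*X - h*s) := by
  have E1 : u2*u3-v2*v3 = X*u1+Y*v1 := by
    rw [hX, hY]; linear_combination -(u2*u3-v2*v3)*n1
  have E2 : u2*v3+v2*u3 = Y*u1-X*v1 := by
    rw [hX, hY]; linear_combination -(u2*v3+v2*u3)*n1
  -- e2 = s E
  have R : s*X = (u1*u2-v1*v2)+(u1*u3-v1*v3)+(u2*u3-v2*v3) := by
    have : (u1+u2+u3)*X+(v1+v2+v3)*Y = (u1*u2-v1*v2)+(u1*u3-v1*v3)+(u2*u3-v2*v3) := by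
      rw [hX, hY]
      linear_combination (u2*u3-v2*v3)*n1 + (u1*u3-v1*v3)*n2 + (u1*u2-v1*v2)*n3
    linear_combination this - X*hs - Y*hv
  have I : s*Y = (u1*v2+v1*u2)+(u1*v3+v1*u3)+(u2*v3+v2*u3) := by
    have : (u1+u2+u3)*Y-(v1+v2+v3)*X = (u1*v2+v1*u2)+(u1*v3+v1*u3)+(u2*v3+v2*u3) := by
      rw [hX, hY]
      linear_combination (u2*v3+v2*u3)*n1 + (u1*v3+v1*u3)*n2 + (u1*v2+v1*u2)*n3
    linear_combination this - Y*hs + X*hv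
  have B : u1^2-v1^2 - s*u1 - (X*u1+Y*v1) + s*X = 0 := by
    linear_combination E1 + R + u1*hs - v1*hv
  have A : X*(u1^2-v1^2)+2*Y*u1*v1 - s*(X*u1+Y*v1) - u1 + s = 0 := by
    linear_combination -u1*E1 - v1*E2 - u1*R - v1*I - hs - (u2+u3)*n1
  linear_combination h*(1-h*s)*B + h^2*A

/-- Area of the limaçon triangle. -/
lemma areaQ (h s : ℝ) (u1 v1 u2 v2 u3 v3 : ℝ) (n1 : u1^2+v1^2=1) (n2 : u2^2+v2^2=1) (n3 : u3^2+v3^2=1)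
    (hs : u1+u2+u3 = s) (hv : v1+v2+v3=0) :
    ((u2-h*(u2^2-v2^2)) - (u1-h*(u1^2-v1^2))) * ((v3-2*h*u3*v3) - (v1-2*h*u1*v1))
      - ((v2-2*h*u2*v2) - (v1-2*h*u1*v1)) * ((u3-h*(u3^2-v3^2)) - (u1-h*(u1^2-v1^2)))
    = ((1-h*s)^2-h^2) * ((u2-u1)*(v3-v1) - (v2-v1)*(u3-u1)) := by
  have i1 : ((u2-u1)*(u3-u1)+(v2-v1)*(v3-v1))*(v2-v3)
      + ((u2-u1)*(v3-v1) - (v2-v1)*(u3-u1))*(u2+u3) = 0 := by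
    grind
  have i2 : ((u2-u1)*(u3-u1)+(v2-v1)*(v3-v1))*(v2*u3-u2*v3)
      + ((u2-u1)*(v3-v1) - (v2-v1)*(u3-u1))*(u2*u3+v2*v3)
      = - ((u2-u1)*(v3-v1) - (v2-v1)*(u3-u1)) := by
    grind
  have a2 : (u2-h*(u2^2-v2^2)) - (u1-h*(u1^2-v1^2))
      = (u2-u1)*(1-h*s+h*u3) - (v2-v1)*(h*v3) := by
    rw [← hs]; linear_combination h*(v2-v1)*hv
  have b2 : (v2-2*h*u2*v2) - (v1-2*h*u1*v1)
      = (v2-v1)*(1-h*s+h*u3) + (u2-u1)*(h*v3) := by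
    rw [← hs]; linear_combination -h*(u2-u1)*hv
  have a3 : (u3-h*(u3^2-v3^2)) - (u1-h*(u1^2-v1^2))
      = (u3-u1)*(1-h*s+h*u2) - (v3-v1)*(h*v2) := by
    rw [← hs]; linear_combination h*(v3-v1)*hv
  have b3 : (v3-2*h*u3*v3) - (v1-2*h*u1*v1)
      = (v3-v1)*(1-h*s+h*u2) + (u3-u1)*(h*v2) := by
    rw [← hs]; linear_combination -h*(u3-u1)*hv
  rw [a2, b2, a3, b3]
  linear_combination (1-h*s)*h*i1 + h^2*i2

/-- Limaçon vertices are equidistant from the explicit center. -/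
lemma equi2 (h s D : ℝ) (hD : D = (1-h*s)^2-h^2) (hD0 : D ≠ 0)
    (u1 v1 u2 v2 u3 v3 : ℝ) (n1 : u1^2+v1^2=1) (n2 : u2^2+v2^2=1) (n3 : u3^2+v3^2=1)
    (hs : u1+u2+u3 = s) (hv : v1+v2+v3=0) (X Y ox oy : ℝ)
    (hX : X = (u1*u2-v1*v2)*u3 - (u1*v2+v1*u2)*v3)
    (hY : Y = (u1*u2-v1*v2)*v3 + (u1*v2+v1*u2)*u3)
    (hox : ox = -h*(1-h*s+h*X)/D) (hoy : oy = -h*(h*Y)/D) :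
    (u1-h*(u1^2-v1^2)-ox)^2 + (v1-2*h*u1*v1-oy)^2
      = 1+h^2+ox^2+oy^2 + 2*h^2*((1-h*s)*s*X+h*s)/D := by
  have F := equi h s u1 v1 u2 v2 u3 v3 n1 n2 n3 hs hv X Y hX hY
  rw [← hD] at F
  have hox' : ox * D = -h*(1-h*s+h*X) := by rw [hox]; field_simp
  have hoy' : oy * D = -h*(h*Y) := by rw [hoy]; field_simp
  have e : 1+h^2+ox^2+oy^2 + 2*h^2*((1-h*s)*s*X+h*s)/D
      = (D*(1+h^2+ox^2+oy^2) + 2*h^2*((1-h*s)*s*X+h*s))/D := by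
    field_simp
  rw [e, eq_div_iff hD0]
  have nq : (u1-h*(u1^2-v1^2))^2 + (v1-2*h*u1*v1)^2 = 1 + h^2 - 2*h*u1 := by
    linear_combination (1 - 2*h*u1 + h^2*(u1^2+v1^2+1))*n1
  linear_combination D*nq - 2*(u1-h*(u1^2-v1^2))*hox' - 2*(v1-2*h*u1*v1)*hoy' - 2*h*F

lemma dst_pos (p q : Pt) (h : p ≠ q) : 0 < dst p q := by
  unfold dst
  apply Real.sqrt_pos.2
  rcases lt_or_eq_of_le (by positivity : 0 ≤ (p.1 - q.1)^2 + (p.2 - q.2)^2) with h' | h'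
  · exact h'
  · exfalso
    apply h
    ext
    · nlinarith [sq_nonneg (p.1-q.1), sq_nonneg (p.2-q.2)]
    · nlinarith [sq_nonneg (p.1-q.1), sq_nonneg (p.2-q.2)]

lemma dst_sq (p q : Pt) : dst p q ^ 2 = (p.1 - q.1)^2 + (p.2 - q.2)^2 := by
  unfold dst
  exact Real.sq_sqrt (by positivity)

lemma dst_symm (p q : Pt) : dst p q = dst q p := by
  unfold dst
  congr 1; ring

lemma refl_val (a b : ℝ) (v q : Pt) (hv : onEllipse a b v) :
    dot (udir v q) (nrm a b v) = (v.1*q.1/a^2 + v.2*q.2/b^2 - 1) / dst v q := by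
  simp only [onEllipse, dot, udir, nrm, Prod.smul_fst, Prod.smul_snd, Prod.fst_sub, Prod.snd_sub,
    smul_eq_mul] at *
  rw [← hv]
  ring

lemma J_sq (a b J : ℝ) (p q : Pt) (h : p ≠ q)
    (e : (p.1*q.1/a^2 + p.2*q.2/b^2 - 1) / dst p q = J) :
    (p.1*q.1/a^2 + p.2*q.2/b^2 - 1)^2 = J^2 * ((p.1 - q.1)^2 + (p.2 - q.2)^2) := by
  have := dst_pos p q h
  rw [← dst_sq, ← e]
  field_simp

lemma ne_dir (a b c : ℝ) (p q : Pt) (hpq : p ≠ q) (u v u' v' d d' : ℝ)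
    (n : u^2+v^2=1) (n' : u'^2+v'^2=1) (hdd : d = a - c*u) (hdd' : d' = a-c*u')
    (p1 : p.1 = b^2*u/d - c) (p2 : p.2 = b^2*v/d)
    (q1 : q.1 = b^2*u'/d' - c) (q2 : q.2 = b^2*v'/d') : u*u'+v*v' ≠ 1 := by
  intro h
  have hu : u = u' := by nlinarith [sq_nonneg (u-u'), sq_nonneg (v-v')]
  have hv : v = v' := by nlinarith [sq_nonneg (u-u'), sq_nonneg (v-v')]
  apply hpq
  subst hu hv
  rw [← hdd'] at hdd
  subst hdd
  ext
  · rw [p1, q1]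
  · rw [p2, q2]

lemma inv_val (a b c ρ h : ℝ) (hb : 0 < b) (ha : 0 < a) (hh : c = 2*a*h) (p : Pt)
    (u v d : ℝ) (n : u^2+v^2=1) (hdd : d = a - c*u) (hd : 0 < d)
    (p1 : p.1 = b^2*u/d - c) (p2 : p.2 = b^2*v/d) :
    inva ρ (-c, 0) p = (-c + ρ^2*a/b^2*(u-h*(u^2-v^2)-h), ρ^2*a/b^2*(v-2*h*u*v)) := by
  have e : (p.1 - -c)^2 + (p.2-0)^2 = b^4/d^2 := by
    rw [p1, p2]
    field_simp
    linear_combination b^4*n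
  simp only [inva]
  rw [e]
  ext
  · simp only [Prod.fst_add, Prod.smul_fst, Prod.fst_sub, smul_eq_mul, p1]
    field_simp
    rw [hdd, hh]
    linear_combination b^2*ρ^2*(-h*a)*n
  · simp only [Prod.snd_add, Prod.smul_snd, Prod.snd_sub, smul_eq_mul, p2]
    field_simp
    rw [hdd, hh]
    ring

lemma nine_val (c G h s D : ℝ) (hG : G ≠ 0) (hD : D = (1-h*s)^2-h^2) (hD0 : D ≠ 0)
    (u1 v1 u2 v2 u3 v3 : ℝ) (n1 : u1^2+v1^2=1) (n2 : u2^2+v2^2=1) (n3 : u3^2+v3^2=1)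
    (hs : u1+u2+u3 = s) (hv : v1+v2+v3=0)
    (hW : (u2-u1)*(v3-v1) - (v2-v1)*(u3-u1) ≠ 0) :
    ∃ X Y : ℝ, X^2+Y^2 = 1 ∧
    ninePointCenter (-c + G*(u1-h*(u1^2-v1^2)-h), G*(v1-2*h*u1*v1))
      (-c + G*(u2-h*(u2^2-v2^2)-h), G*(v2-2*h*u2*v2))
      (-c + G*(u3-h*(u3^2-v3^2)-h), G*(v3-2*h*u3*v3))
    = (-c + G*(s*(1-h*s) - 2*h + h*(1-h*s)/D)/2 + G*(2*h*s+h^2/D)/2 * X, G*(2*h*s+h^2/D)/2 * Y) := by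
  obtain ⟨X, hX⟩ : ∃ X, X = (u1*u2-v1*v2)*u3 - (u1*v2+v1*u2)*v3 := ⟨_, rfl⟩
  obtain ⟨Y, hY⟩ : ∃ Y, Y = (u1*u2-v1*v2)*v3 + (u1*v2+v1*u2)*u3 := ⟨_, rfl⟩
  obtain ⟨ox, hox⟩ : ∃ ox, ox = -h*(1-h*s+h*X)/D := ⟨_, rfl⟩
  obtain ⟨oy, hoy⟩ : ∃ oy, oy = -h*(h*Y)/D := ⟨_, rfl⟩
  refine ⟨X, Y, ?_, ?_⟩
  · have : X^2+Y^2 = (u1^2+v1^2)*(u2^2+v2^2)*(u3^2+v3^2) := by rw [hX, hY]; ring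
    rw [this, n1, n2, n3]; norm_num
  have k1 := equi2 h s D hD hD0 u1 v1 u2 v2 u3 v3 n1 n2 n3 hs hv X Y ox oy hX hY hox hoy
  have k2 := equi2 h s D hD hD0 u2 v2 u3 v3 u1 v1 n2 n3 n1 (by linarith) (by linarith) X Y ox oy
    (by rw [hX]; ring) (by rw [hY]; ring) hox hoy
  have k3 := equi2 h s D hD hD0 u3 v3 u1 v1 u2 v2 n3 n1 n2 (by linarith) (by linarith) X Y ox oy
    (by rw [hX]; ring) (by rw [hY]; ring) hox hoy
  have hA := areaQ h s u1 v1 u2 v2 u3 v3 n1 n2 n3 hs hv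
  rw [← hD] at hA
  have R : s*X = (u1*u2-v1*v2)+(u1*u3-v1*v3)+(u2*u3-v2*v3) := by
    have : (u1+u2+u3)*X+(v1+v2+v3)*Y = (u1*u2-v1*v2)+(u1*u3-v1*v3)+(u2*u3-v2*v3) := by
      rw [hX, hY]
      linear_combination (u2*u3-v2*v3)*n1 + (u1*u3-v1*v3)*n2 + (u1*u2-v1*v2)*n3
    linear_combination this - X*hs - Y*hv
  have I : s*Y = (u1*v2+v1*u2)+(u1*v3+v1*u3)+(u2*v3+v2*u3) := by
    have : (u1+u2+u3)*Y-(v1+v2+v3)*X = (u1*v2+v1*u2)+(u1*v3+v1*u3)+(u2*v3+v2*u3) := by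
      rw [hX, hY]
      linear_combination (u2*v3+v2*u3)*n1 + (u1*v3+v1*u3)*n2 + (u1*v2+v1*u2)*n3
    linear_combination this - Y*hs + X*hv
  have Sx : (u1^2-v1^2)+(u2^2-v2^2)+(u3^2-v3^2) = s^2 - 2*s*X := by
    linear_combination 2*R + (u1+u2+u3+s)*hs - (v1+v2+v3)*hv
  have Sy : 2*u1*v1+2*u2*v2+2*u3*v3 = - 2*s*Y := by
    linear_combination 2*I + 2*(u1+u2+u3)*hv
  have cc := cc_eq (-c + G*(u1-h*(u1^2-v1^2)-h), G*(v1-2*h*u1*v1))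
      (-c + G*(u2-h*(u2^2-v2^2)-h), G*(v2-2*h*u2*v2))
      (-c + G*(u3-h*(u3^2-v3^2)-h), G*(v3-2*h*u3*v3))
      (-c + G*(ox-h), G*oy)
      (by linear_combination G^2*(k1-k2)) (by linear_combination G^2*(k1-k3))
      (by
        intro h0
        have : G^2 * (D * ((u2-u1)*(v3-v1) - (v2-v1)*(u3-u1))) = 0 := by
          rw [← hA, ← h0]; ring
        simp [hG, hD0, hW] at this)
  unfold ninePointCenter orthocenter
  rw [cc]
  ext
  · simp only [Prod.fst_add, Prod.smul_fst, Prod.fst_sub, smul_eq_mul]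
    have : ox = -(h*(1-h*s)/D) - h^2/D*X := by rw [hox]; ring
    rw [this]
    linear_combination G/2*hs - G*h/2*Sx
  · simp only [Prod.snd_add, Prod.smul_snd, Prod.snd_sub, smul_eq_mul]
    have : oy = - h^2/D*Y := by rw [hoy]; ring
    rw [this]
    linear_combination G/2*hv - G*h/2*Sy


/-- over the 3-periodic billiard family, the nine-point center X(5) of the
focus-inversive triangle lies on the stated circle. -/
theorem focus_inversive_ninePointCenter_circle (a b ρ : ℝ) (hab : a > b) (hb : b > 0)
    (hρ : ρ > 0) (T : Orbit3 a b) :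
    let c : ℝ := Real.sqrt (a ^ 2 - b ^ 2)
    let δ : ℝ := Real.sqrt (a ^ 4 - a ^ 2 * b ^ 2 + b ^ 4)
    let f1 : Pt := (-c, 0)
    let Ctr : Pt := (c * (-1 + ρ ^ 2 * (a ^ 4 - 3 * a ^ 2 * b ^ 2 + 2 * b ^ 4 + 2 * b ^ 2 * δ) / (4 * a ^ 2 * b ^ 4)), 0)
    dst (ninePointCenter (inva ρ f1 T.P1) (inva ρ f1 T.P2) (inva ρ f1 T.P3)) Ctr =
      ρ ^ 2 * ((3 * a ^ 2 - 2 * b ^ 2) * b ^ 2 + (a ^ 2 - 2 * b ^ 2) * δ) / (4 * a * b ^ 2 * b ^ 2) := by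
  intro c δ f1 Ctr
  have ha : 0 < a := by linarith
  have hab2 : 0 < a^2 - b^2 := by nlinarith
  have hc : 0 < c := Real.sqrt_pos.2 hab2
  have hcc : c^2 = a^2 - b^2 := Real.sq_sqrt hab2.le
  have hδ0 : 0 < a^4 - a^2*b^2 + b^4 := by
    have : 0 < a^2 * (a^2-b^2) := by positivity
    have : 0 < b^4 := by positivity
    nlinarith
  have hδ : 0 < δ := Real.sqrt_pos.2 hδ0
  have hδδ : δ^2 = a^4 - a^2*b^2 + b^4 := Real.sq_sqrt hδ0.le
  have hf : f1 = (-c, 0) := rfl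
  have hC : Ctr = (c * (-1 + ρ ^ 2 * (a ^ 4 - 3 * a ^ 2 * b ^ 2 + 2 * b ^ 4 + 2 * b ^ 2 * δ) / (4 * a ^ 2 * b ^ 4)), 0) := rfl
  rw [hf, hC]
  clear_value c δ
  obtain ⟨P1, P2, P3, h1, h2, h3, d12, d23, d31, r1, r2, r3⟩ := T
  simp only
  obtain ⟨u1, v1, e1, n1, E1, ep1, x1, y1⟩ := param a b c hb hc hab hcc P1 h1
  obtain ⟨u2, v2, e2, n2, E2, ep2, x2, y2⟩ := param a b c hb hc hab hcc P2 h2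
  obtain ⟨u3, v3, e3, n3, E3, ep3, x3, y3⟩ := param a b c hb hc hab hcc P3 h3
  have k12 := ne_dir a b c P1 P2 d12 u1 v1 u2 v2 e1 e2 n1 n2 E1 E2 x1 y1 x2 y2
  have k23 := ne_dir a b c P2 P3 d23 u2 v2 u3 v3 e2 e3 n2 n3 E2 E3 x2 y2 x3 y3
  have k31 := ne_dir a b c P3 P1 d31 u3 v3 u1 v1 e3 e1 n3 n1 E3 E1 x3 y3 x1 y1
  have hW := unit_W u1 v1 u2 v2 u3 v3 n1 n2 n3 k12 k23 k31
  unfold reflectAt at r1 r2 r3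
  rw [refl_val a b _ _ h1, refl_val a b _ _ h1] at r1
  rw [refl_val a b _ _ h2, refl_val a b _ _ h2] at r2
  rw [refl_val a b _ _ h3, refl_val a b _ _ h3] at r3
  obtain ⟨J, hJ⟩ : ∃ J, (P1.1*P2.1/a^2 + P1.2*P2.2/b^2 - 1) / dst P1 P2 = J := ⟨_, rfl⟩
  have j12 := J_sq a b J P1 P2 d12 hJ
  have j23 := J_sq a b J P2 P3 d23 (by
    rw [← r2, ← hJ, dst_symm P1 P2, mul_comm P1.1, mul_comm P1.2])
  have j31 := J_sq a b J P3 P1 d31 (by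
    rw [← hJ, ← r1, dst_symm P3 P1, mul_comm P1.1, mul_comm P1.2])
  rw [x1, y1, x2, y2] at j12
  rw [x2, y2, x3, y3] at j23
  rw [x3, y3, x1, y1] at j31
  have q12 := pair a b c (J^2) hb hab hcc u1 v1 u2 v2 e1 e2 n1 n2 E1 E2 ep1 ep2 k12 j12
  have q23 := pair a b c (J^2) hb hab hcc u2 v2 u3 v3 e2 e3 n2 n3 E2 E3 ep2 ep3 k23 j23
  have q31 := pair a b c (J^2) hb hab hcc u3 v3 u1 v1 e3 e1 n3 n1 E3 E1 ep3 ep1 k31 j31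
  obtain ⟨hV, hS⟩ := sums a b c δ (J^2) hb hc hab hcc (sq_nonneg J) hδ hδδ u1 v1 u2 v2 u3 v3
    n1 n2 n3 hW q12 q23 q31
  obtain ⟨s, hs⟩ : ∃ s, u1+u2+u3 = s := ⟨_, rfl⟩
  rw [hs] at hS
  obtain ⟨h, hh⟩ : ∃ h, h = c/(2*a) := ⟨_, rfl⟩
  have hca : c = 2*a*h := by rw [hh]; field_simp
  rw [inv_val a b c ρ h hb ha hca P1 u1 v1 e1 n1 E1 ep1 x1 y1,
    inv_val a b c ρ h hb ha hca P2 u2 v2 e2 n2 E2 ep2 x2 y2,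
    inv_val a b c ρ h hb ha hca P3 u3 v3 e3 n3 E3 ep3 x3 y3]
  have hsv : s = (2*a^2-b^2-δ)/(a*c) := by rw [← hS]; field_simp
  have hσ : 1 - h*s = (δ+b^2)/(2*a^2) := by
    rw [hsv, hh]; field_simp; ring
  have hD : b^2*(b^2+δ)/(2*a^4) = (1-h*s)^2 - h^2 := by
    rw [hσ, hh]
    field_simp
    linear_combination -hδδ + a^2*hcc
  have hD0 : b^2*(b^2+δ)/(2*a^4) ≠ 0 := by positivity
  obtain ⟨X, Y, hXY, hN⟩ := nine_val c (ρ^2*a/b^2) h s _ (by positivity) hD hD0 u1 v1 u2 v2 u3 v3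
    n1 n2 n3 hs hV hW
  rw [hN]
  have hR : ρ^2*a/b^2*(2*h*s+h^2/(b^2*(b^2+δ)/(2*a^4)))/2
      = ρ ^ 2 * ((3 * a ^ 2 - 2 * b ^ 2) * b ^ 2 + (a ^ 2 - 2 * b ^ 2) * δ) / (4 * a * b ^ 2 * b ^ 2) := by
    have t1 : 2*h*s = (2*a^2-b^2-δ)/a^2 := by rw [hsv, hh]; field_simp
    have t2 : h^2/(b^2*(b^2+δ)/(2*a^4)) = (δ-b^2)/(2*b^2) := by
      rw [hh]; field_simp; linear_combination a^2*hcc - hδδ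
    rw [t1, t2]; field_simp; ring
  have hCt : -c + ρ^2*a/b^2*(s*(1-h*s) - 2*h + h*(1-h*s)/(b^2*(b^2+δ)/(2*a^4)))/2
      = c * (-1 + ρ ^ 2 * (a ^ 4 - 3 * a ^ 2 * b ^ 2 + 2 * b ^ 4 + 2 * b ^ 2 * δ) / (4 * a ^ 2 * b ^ 4)) := by
    have t1 : s*(1-h*s) = c*(2*δ-a^2+2*b^2)/(2*a^3) := by
      rw [hσ, hsv]; field_simp
      rw [hcc]; linear_combination -hδδ
    have t2 : h*(1-h*s)/(b^2*(b^2+δ)/(2*a^4)) = c*a/(2*b^2) := by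
      rw [hσ, hh]; field_simp; ring
    rw [t1, t2, hh]; field_simp; ring
  rw [hR, hCt]
  have hRpos : 0 ≤ ρ ^ 2 * ((3 * a ^ 2 - 2 * b ^ 2) * b ^ 2 + (a ^ 2 - 2 * b ^ 2) * δ) / (4 * a * b ^ 2 * b ^ 2) := by
    rw [← hR]
    have hs0 : 0 ≤ s := by
      rw [hsv]
      apply div_nonneg _ (by positivity)
      have : δ ≤ 2*a^2-b^2 := by
        have hp : 0 ≤ 2*a^2-b^2 := by have := sq_nonneg a; linarith
        have hq : δ^2 ≤ (2*a^2-b^2)^2 := by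
          rw [hδδ]
          have : 0 < a^2*(a^2-b^2) := by positivity
          linarith
        exact (pow_le_pow_iff_left₀ hδ.le hp two_ne_zero).1 hq
      linarith
    have hh0 : 0 < h := by rw [hh]; positivity
    positivity
  obtain ⟨R, hRR⟩ : ∃ R, R = ρ ^ 2 * ((3 * a ^ 2 - 2 * b ^ 2) * b ^ 2 + (a ^ 2 - 2 * b ^ 2) * δ) / (4 * a * b ^ 2 * b ^ 2) := ⟨_, rfl⟩
  rw [← hRR] at hRpos ⊢
  unfold dst
  simp only
  rw [show ∀ k : ℝ, (k + R*X - k)^2 + (R*Y-0)^2 = R^2 from fun k => by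
    linear_combination R^2*hXY]
  exact Real.sqrt_sq hRpos
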